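/- Let d ≥ 1 and let λ, ν be partitions of n ≥ 1, where d does not divide n. Then the character value χ^{⊞^d(λ)}_{d²·ν} equals 0. -/

import Mathlib

open MvPolynomial Finset

/-- The `r`-th power sum polynomial `p_r = x_1^r + ⋯ + x_N^r`. -/
noncomputable def psum (N r : ℕ) : MvPolynomial (Fin N) ℤ := ∑ i, X i ^ r

/-- The power sum product `p_μ = p_{μ_1} ⋯ p_{μ_k}` for a partition `μ`. -/
noncomputable def pprod (N : ℕ) {n : ℕ} (mu : Nat.Partition n) : MvPolynomial (Fin N) ℤ :=
  (mu.parts.map (psum N)).prod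

/-- The Vandermonde product `∏_{i<j} (x_i - x_j)`. -/
noncomputable def vandermonde (N : ℕ) : MvPolynomial (Fin N) ℤ :=
  ∏ p ∈ univ.filter (fun p : Fin N × Fin N => p.1 < p.2), (X p.1 - X p.2)

/-- The irreducible character value `χ^λ_μ` of `S_N`, via the Frobenius character formula:
the coefficient of `x_1^{λ_1 + N - 1} x_2^{λ_2 + N - 2} ⋯ x_N^{λ_N}` in `∏_{i<j}(x_i - x_j) ⋅ p_μ`,
where `λ` is padded with trailing zeros to length `N`. -/
noncomputable def chi {N : ℕ} (l m : Nat.Partition N) : ℤ :=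
  coeff (Finsupp.equivFunOnFinite.symm fun i : Fin N =>
    (l.parts.sort (· ≥ ·)).getD i 0 + (N - 1 - (i : ℕ))) (vandermonde N * pprod N m)

/-- `⊞^d(λ)`: replace each part `p` of `λ` by `d` copies of `d⋅p`; a partition of `d²n`. -/
def boxplus (d : ℕ) {n : ℕ} (P : Nat.Partition n) : Nat.Partition (d * (d * n)) where
  parts := P.parts.bind fun p => Multiset.replicate d (d * p)
  parts_pos := by
    intro i hi
    simp only [Multiset.mem_bind, Multiset.mem_replicate] at hi
    obtain ⟨p, hp, hd, rfl⟩ := hi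
    exact Nat.mul_pos (Nat.pos_of_ne_zero hd) (P.parts_pos hp)
  parts_sum := by
    rw [Multiset.sum_bind]
    simp only [Multiset.sum_replicate, smul_eq_mul]
    rw [Multiset.sum_map_mul_left, Multiset.sum_map_mul_left, Multiset.map_id', P.parts_sum]

/-- `d⋅λ`: multiply every part of `λ` by `d`; a partition of `dn`. -/
def scale (d : ℕ) (hd : 0 < d) {n : ℕ} (P : Nat.Partition n) : Nat.Partition (d * n) where
  parts := P.parts.map (d * ·)
  parts_pos := by
    intro i hi
    obtain ⟨p, hp, rfl⟩ := Multiset.mem_map.mp hi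
    exact Nat.mul_pos hd (P.parts_pos hp)
  parts_sum := by rw [Multiset.sum_map_mul_left, Multiset.map_id', P.parts_sum]

/-- Every monomial of the Vandermonde product has exponent vector a permutation of
`(0, …, N - 1)`. -/
theorem exists_perm_of_mem_support_vandermonde {N : ℕ} {a : Fin N →₀ ℕ}
    (ha : a ∈ (vandermonde N).support) :
    ∃ σ : Equiv.Perm (Fin N), ∀ i, a i = (σ i : ℕ) := by
  have hdet : vandermonde N =
      (Matrix.vandermonde fun i : Fin N => (-X i : MvPolynomial (Fin N) ℤ)).det := by
    rw [Matrix.det_vandermonde, vandermonde, prod_filter, ← univ_product_univ, prod_product]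
    refine prod_congr rfl fun i _ => ?_
    rw [← prod_filter]
    refine prod_congr (by ext; simp) fun j _ => by ring
  rw [hdet, Matrix.det_apply] at ha
  obtain ⟨σ, -, hσ⟩ := mem_biUnion.mp (support_sum ha)
  refine ⟨σ⁻¹, fun i => ?_⟩
  have hmon : ∏ i : Fin N, Matrix.vandermonde (fun i => (-X i : MvPolynomial (Fin N) ℤ)) (σ i) i =
      monomial (Finsupp.equivFunOnFinite.symm fun j => ((σ⁻¹ j : Fin N) : ℕ))
        (∏ i : Fin N, (-1) ^ (i : ℕ)) := by
    rw [monomial_eq, Finsupp.prod_fintype _ _ (by simp), ← Equiv.prod_comp σ (fun j => X j ^ _),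
      map_prod, ← prod_mul_distrib]
    refine prod_congr rfl fun i _ => ?_
    simp [Matrix.vandermonde_apply, neg_pow (X (σ i) : MvPolynomial (Fin N) ℤ)]
  rw [hmon, Units.smul_def, smul_monomial] at hσ
  rw [mem_singleton.mp (support_monomial_subset hσ)]
  rfl

/-- If `M` divides every entry of the multiset `s`, every monomial of the corresponding product
of power sums has all its exponents divisible by `M`. -/
theorem dvd_of_mem_support_prod_psum {N M : ℕ} (s : Multiset ℕ) (hs : ∀ k ∈ s, M ∣ k)
    {b : Fin N →₀ ℕ} (hb : b ∈ ((s.map (psum N)).prod).support) (i : Fin N) : M ∣ b i := by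
  classical
  induction s using Multiset.induction_on generalizing b with
  | empty =>
    rw [Multiset.map_zero, Multiset.prod_zero, mem_support_iff, coeff_one] at hb
    have : b = 0 := by by_contra h; exact hb (if_neg (Ne.symm h))
    simp [this]
  | cons k s ih =>
    rw [Multiset.map_cons, Multiset.prod_cons] at hb
    obtain ⟨u, hu, v, hv, rfl⟩ := mem_add.mp (support_mul _ _ hb)
    refine dvd_add ?_ (ih (fun k hk => hs k (Multiset.mem_cons_of_mem hk)) hv)
    obtain ⟨j, -, hj⟩ := mem_biUnion.mp (support_sum hu)
    rw [support_X_pow, mem_singleton] at hj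
    rw [hj, Finsupp.single_apply]
    split_ifs
    · exact hs k (Multiset.mem_cons_self k s)
    · exact dvd_zero M

theorem getD_flatMap_replicate {d r : ℕ} (hr : r < d) (L : List ℕ) (q : ℕ) :
    (L.flatMap fun p => List.replicate d (d * p)).getD (d * q + r) 0 = d * L.getD q 0 := by
  induction L generalizing q with
  | nil => simp
  | cons p L ih =>
    rw [List.flatMap_cons]
    cases q with
    | zero =>
      rw [List.getD_append _ _ _ _ (by simpa using hr)]
      simp [hr]
    | succ q =>
      rw [List.getD_append_right _ _ _ _ (by simp; nlinarith)]
      have : d * (q + 1) + r - (List.replicate d (d * p)).length = d * q + r := by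
        rw [List.length_replicate, mul_add_one]; omega
      rw [this, ih, List.getD_cons_succ]

theorem sort_boxplus {d n : ℕ} (P : Nat.Partition n) :
    (boxplus d P).parts.sort (· ≥ ·) =
      (P.parts.sort (· ≥ ·)).flatMap fun p => List.replicate d (d * p) := by
  have hsort : ((P.parts.sort (· ≥ ·)).flatMap fun p => List.replicate d (d * p)).Pairwise
      (· ≥ ·) := by
    rw [List.pairwise_flatMap]
    refine ⟨fun p _ => List.pairwise_replicate.mpr (Or.inr le_rfl), ?_⟩
    refine (P.parts.pairwise_sort (· ≥ ·)).imp fun {p q} hpq x hx y hy => ?_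
    rw [List.eq_of_mem_replicate hx, List.eq_of_mem_replicate hy]
    exact Nat.mul_le_mul_left d hpq
  refine List.Perm.eq_of_pairwise' ((boxplus d P).parts.pairwise_sort (· ≥ ·)) hsort ?_
  rw [← Multiset.coe_eq_coe, Multiset.sort_eq, ← Multiset.coe_bind, Multiset.sort_eq]
  rfl

theorem sum_range_getD_eq_sum (L : List ℕ) {m : ℕ} (hm : L.length ≤ m) :
    ∑ q ∈ range m, L.getD q 0 = L.sum := by
  induction L generalizing m with
  | nil => simp
  | cons p L ih =>
    obtain ⟨m, rfl⟩ : ∃ k, m = k + 1 := ⟨m - 1, by simp at hm; omega⟩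
    rw [sum_range_succ', List.sum_cons]
    simp only [List.getD_cons_succ, List.getD_cons_zero]
    rw [ih (by simpa using hm), add_comm]

theorem sum_range_mul_ite_mod {d : ℕ} (hd : 0 < d) (m : ℕ) (f : ℕ → ℕ) :
    ∑ i ∈ range (d * m), (if i % d = d - 1 then f i else 0) =
      ∑ q ∈ range m, f (d * q + (d - 1)) := by
  induction m with
  | zero => simp
  | succ m ih =>
    rw [mul_add_one, sum_range_add, ih, sum_range_succ]
    congr 1
    rw [sum_eq_single_of_mem (d - 1) (by simp; omega)]
    · simp [Nat.mod_eq_of_lt (Nat.sub_lt hd one_pos)]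
    · intro i hi hne
      rw [Nat.mul_add_mod, Nat.mod_eq_of_lt (mem_range.mp hi), if_neg hne]

theorem length_sort_parts_le {n : ℕ} (P : Nat.Partition n) :
    (P.parts.sort (· ≥ ·)).length ≤ n := by
  rw [Multiset.length_sort]
  have h := Multiset.card_nsmul_le_sum (s := P.parts) (a := 1) fun x hx => P.parts_pos hx
  simpa [P.parts_sum] using h

/-- The quotient by `d` on multiples of `d`, extended by zero, viewed modulo `d`, only depends on
the argument modulo `d²`. -/
theorem ite_dvd_div_modEq {d x y : ℕ} (hd : 0 < d) (h : x ≡ y [MOD d * d]) :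
    (if d ∣ x then x / d else 0) ≡ (if d ∣ y then y / d else 0) [MOD d] := by
  have hiff : d ∣ x ↔ d ∣ y := (h.of_mul_left d).dvd_iff dvd_rfl
  by_cases hx : d ∣ x
  · rw [if_pos hx, if_pos (hiff.mp hx)]
    obtain ⟨u, rfl⟩ := hx
    obtain ⟨v, rfl⟩ := hiff.mp ⟨u, rfl⟩
    rw [Nat.mul_div_cancel_left _ hd, Nat.mul_div_cancel_left _ hd]
    exact Nat.ModEq.mul_left_cancel' hd.ne' h
  · rw [if_neg hx, if_neg (mt hiff.mpr hx)]

/-- Adding `⊞^d(λ)` to the staircase `(N - 1, …, 1, 0)` raises the sum of the quotients by `d`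
of the entries divisible by `d` by exactly `|λ|`. -/
theorem sum_ite_dvd_div_boxplus {d n : ℕ} (hd : 0 < d) (P : Nat.Partition n) :
    ∑ i : Fin (d * (d * n)),
        (if d ∣ ((boxplus d P).parts.sort (· ≥ ·)).getD i 0 + (d * (d * n) - 1 - (i : ℕ)) then
          (((boxplus d P).parts.sort (· ≥ ·)).getD i 0 + (d * (d * n) - 1 - (i : ℕ))) / d else 0) =
      n + ∑ i : Fin (d * (d * n)), (if d ∣ (i : ℕ) then (i : ℕ) / d else 0) := by
  set L := P.parts.sort (· ≥ ·)
  have hget (i : ℕ) : ((boxplus d P).parts.sort (· ≥ ·)).getD i 0 = d * L.getD (i / d) 0 := by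
    conv_lhs => rw [← Nat.div_add_mod i d]
    rw [sort_boxplus, getD_flatMap_replicate (Nat.mod_lt i hd)]
  have hsum : ∑ i : Fin (d * (d * n)), (if (i : ℕ) % d = d - 1 then L.getD (i / d) 0 else 0) =
      n := by
    rw [Fin.sum_univ_eq_sum_range (fun i => if i % d = d - 1 then L.getD (i / d) 0 else 0),
      sum_range_mul_ite_mod hd _ fun i => L.getD (i / d) 0]
    have hdiv (q : ℕ) : (d * q + (d - 1)) / d = q := by
      rw [Nat.mul_add_div hd, Nat.div_eq_of_lt (by omega), add_zero]
    simp only [hdiv]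
    rw [sum_range_getD_eq_sum _ ((length_sort_parts_le P).trans (Nat.le_mul_of_pos_left n hd)),
      ← Multiset.sum_coe, Multiset.sort_eq, P.parts_sum]
  rw [← Equiv.sum_comp Fin.revPerm fun i : Fin (d * (d * n)) =>
    if d ∣ (i : ℕ) then (i : ℕ) / d else 0]
  refine Eq.trans ?_ (congrArg (· + _) hsum)
  rw [← sum_add_distrib]
  refine sum_congr rfl fun i _ => ?_
  have hrev : (Fin.revPerm i : ℕ) = d * (d * n) - 1 - i := by
    rw [Fin.revPerm_apply, Fin.val_rev]; omega
  have hiff : d ∣ d * (d * n) - 1 - (i : ℕ) ↔ (i : ℕ) % d = d - 1 := by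
    have hi : d * (d * n) - 1 - (i : ℕ) + (i + 1) = d * (d * n) := by have := i.2; omega
    have hN : d ∣ d * (d * n) - 1 - (i : ℕ) + (i + 1) := by
      rw [hi]; exact dvd_mul_right d _
    have h1 : d ∣ d * (d * n) - 1 - (i : ℕ) ↔ d ∣ (i : ℕ) + 1 :=
      ⟨fun h => (Nat.dvd_add_right h).mp hN, fun h => (Nat.dvd_add_left h).mp hN⟩
    rw [h1]
    have hlt := Nat.mod_lt (i : ℕ) hd
    have h2 : d ∣ (i : ℕ) + 1 ↔ d ∣ (i : ℕ) % d + 1 := by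
      conv_lhs => rw [← Nat.div_add_mod (i : ℕ) d, add_assoc]
      exact Nat.dvd_add_right (dvd_mul_right d _)
    rw [h2]
    constructor
    · intro h
      have := Nat.le_of_dvd (Nat.succ_pos _) h
      omega
    · intro h
      rw [h, Nat.sub_add_cancel hd]
  rw [hget, hrev]
  simp only [Nat.dvd_add_right (dvd_mul_right d _)]
  by_cases h : d ∣ d * (d * n) - 1 - (i : ℕ)
  · rw [if_pos h, if_pos h, if_pos (hiff.mp h), Nat.mul_add_div hd]
  · rw [if_neg h, if_neg h, if_neg (mt hiff.mpr h)]

/-- **Miller's vanishing** (second part of Theorem 2): for `d ≥ 1` and `λ, ν ⊢ n ≥ 1` with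
`d ∤ n`, we have `χ^{⊞^d(λ)}_{d²·ν} = 0`. -/
theorem boxplus_char_value_eq_zero (d n : ℕ) (hd : 1 ≤ d) (hn : 1 ≤ n) (hdvd : ¬ d ∣ n)
    (lam nu : Nat.Partition n) :
    chi (boxplus d lam) (scale d hd (scale d hd nu)) = 0 := by
  by_contra hne
  obtain ⟨a, ha, b, hb, hab⟩ := mem_add.mp (support_mul _ _ (mem_support_iff.mpr hne))
  obtain ⟨σ, hσ⟩ := exists_perm_of_mem_support_vandermonde ha
  have hdvd_b (i) : d * d ∣ b i := by
    refine dvd_of_mem_support_prod_psum _ (fun k hk => ?_) hb i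
    obtain ⟨l, hl, rfl⟩ := Multiset.mem_map.mp hk
    obtain ⟨p, -, rfl⟩ := Multiset.mem_map.mp hl
    exact ⟨p, (mul_assoc d d p).symm⟩
  have hmod (i : Fin (d * (d * n))) :
      ((boxplus d lam).parts.sort (· ≥ ·)).getD i 0 + (d * (d * n) - 1 - (i : ℕ)) ≡
        (σ i : ℕ) [MOD d * d] := by
    have h := DFunLike.congr_fun hab i
    rw [Finsupp.add_apply, hσ, Finsupp.equivFunOnFinite_symm_apply_apply] at h
    rw [← h]
    exact Nat.ModEq.add_left _ (Nat.modEq_zero_iff_dvd.mpr (hdvd_b i))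
  have key := Nat.ModEq.sum (s := univ) fun i _ => ite_dvd_div_modEq hd (hmod i)
  rw [sum_ite_dvd_div_boxplus hd,
    Equiv.sum_comp σ fun i : Fin (d * (d * n)) => if d ∣ (i : ℕ) then (i : ℕ) / d else 0] at key
  exact hdvd (Nat.modEq_zero_iff_dvd.mp
    (Nat.ModEq.add_right_cancel' _ (key.trans (by rw [zero_add]))))
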